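/- For the graph G_n (n ≥ 2) consisting of n − 1 squares sharing vertices in a linear chain, each square having two additional pendant-like triangle structures as defined (with 2n−3 'column' vertices of which the structure yields weights as in the paper), the degree distance satisfies DD(G_n) = 64n³ + 100n² − 24n + 28. -/

import Mathlib

noncomputable section

/-- Vertex set of the graph `Gₙ` from Klavžar–Nadjafi-Arani (n ≥ 2): `2n − 3` "columns" of three
vertices each, together with two end gadgets of five vertices each; `|V(Gₙ)| = 6n + 1`. -/
def GnV (n : ℕ) : Type :=
  Fin 5 ⊕ (Fin 5 ⊕ (Fin (2 * n - 3) × Fin 3))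

instance (n : ℕ) : Fintype (GnV n) := by unfold GnV; infer_instance
instance (n : ℕ) : DecidableEq (GnV n) := by unfold GnV; infer_instance

/-- Internal edges of an end gadget on five vertices `0,…,4`. -/
def gadgetRel (a a' : Fin 5) : Prop :=
  ((a : ℕ) = 0 ∧ (a' : ℕ) = 3) ∨ ((a : ℕ) = 1 ∧ (a' : ℕ) = 3) ∨
  ((a : ℕ) = 1 ∧ (a' : ℕ) = 4) ∨ ((a : ℕ) = 2 ∧ (a' : ℕ) = 4)

/-- The base relation generating the edges of `Gₙ`: the three horizontal strands joining
consecutive columns, the two vertical edges of every even-indexed column (the block columns,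
the odd-indexed columns being the triples of degree-two "middle" vertices), the left end
gadget attached to column `0`, and the right end gadget attached to column `2n − 4`. -/
def GnRel (n : ℕ) : GnV n → GnV n → Prop
  | Sum.inl a, Sum.inl a' => gadgetRel a a'
  | Sum.inl a, Sum.inr (Sum.inr ck) => (ck.1 : ℕ) = 0 ∧ (a : ℕ) = (ck.2 : ℕ)
  | Sum.inr (Sum.inl a), Sum.inr (Sum.inl a') => gadgetRel a a'
  | Sum.inr (Sum.inl a), Sum.inr (Sum.inr ck) => (ck.1 : ℕ) = 2 * n - 4 ∧ (a : ℕ) = (ck.2 : ℕ)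
  | Sum.inr (Sum.inr ck), Sum.inr (Sum.inr ck') =>
      ((ck.1 : ℕ) = (ck'.1 : ℕ) ∧ (ck.1 : ℕ) % 2 = 0 ∧ (ck'.2 : ℕ) = (ck.2 : ℕ) + 1) ∨
      ((ck'.1 : ℕ) = (ck.1 : ℕ) + 1 ∧ (ck.2 : ℕ) = (ck'.2 : ℕ))
  | _, _ => False

/-- The graph `Gₙ`, `n ≥ 2` (the family of Klavžar–Nadjafi-Arani with `n` vertical layers,
`6n + 1` vertices and `8n` edges). -/
def Gn (n : ℕ) : SimpleGraph (GnV n) := SimpleGraph.fromRel (GnRel n)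

/-- The degree of a vertex (as a real number). -/
noncomputable def SimpleGraph.degR {V : Type*} (G : SimpleGraph V) (u : V) : ℝ :=
  Nat.card {w : V | G.Adj u w}

/-- The degree distance `DD(G) = ∑_{{u,v}⊆V(G)} (deg(u)+deg(v)) d(u,v)`. -/
noncomputable def SimpleGraph.degreeDistance {V : Type*} [Fintype V] (G : SimpleGraph V) : ℝ :=
  (1 / 2) * ∑ u : V, ∑ v : V, (G.degR u + G.degR v) * (G.dist u v : ℝ)

/-- If `D` vanishes on the diagonal, changes by at most one along edges, and can be decreased along
an edge away from the diagonal, then `D` is the graph distance. -/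
theorem SimpleGraph.dist_eq_of_local {V : Type*} (G : SimpleGraph V) (D : V → V → ℕ)
    (h_self : ∀ v, D v v = 0)
    (h_adj : ∀ u v w, G.Adj u v → D u w ≤ D v w + 1)
    (h_desc : ∀ u w, u ≠ w → ∃ v, G.Adj u v ∧ D v w < D u w) (u w : V) :
    G.dist u w = D u w := by
  have lower : ∀ {u w : V} (p : G.Walk u w), D u w ≤ p.length := by
    intro u w p
    induction p with
    | nil => simp [h_self]
    | cons h p ih =>
      rw [SimpleGraph.Walk.length_cons]
      exact (h_adj _ _ _ h).trans (by omega)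
  have upper : ∀ (k : ℕ) (u w : V), D u w ≤ k → ∃ p : G.Walk u w, p.length ≤ k := by
    intro k
    induction k with
    | zero =>
      intro u w h
      by_cases huw : u = w
      · subst huw
        exact ⟨.nil, by simp⟩
      · obtain ⟨v, -, hv⟩ := h_desc u w huw
        omega
    | succ k ih =>
      intro u w h
      by_cases huw : u = w
      · subst huw
        exact ⟨.nil, by simp⟩
      · obtain ⟨v, huv, hv⟩ := h_desc u w huw
        obtain ⟨p, hp⟩ := ih v w (by omega)
        exact ⟨.cons huv p, by simpa using hp⟩
  obtain ⟨p, hp⟩ := upper _ u w le_rfl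
  refine le_antisymm ((SimpleGraph.dist_le p).trans hp) ?_
  obtain ⟨q, hq⟩ := SimpleGraph.Reachable.exists_walk_length_eq_dist (G := G) ⟨p⟩
  exact hq ▸ lower q

namespace Gn

/-- Horizontal coordinate of a vertex, between `0` and `2n`. -/
def xc {n : ℕ} : GnV n → ℕ
  | Sum.inl a => if (a : ℕ) < 3 then 1 else 0
  | Sum.inr (Sum.inl a) => if (a : ℕ) < 3 then 2 * n - 1 else 2 * n
  | Sum.inr (Sum.inr ck) => ck.1 + 2

/-- Vertical coordinate of a vertex, between `0` and `4`; the strands have even coordinate. -/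
def yc {n : ℕ} : GnV n → ℕ
  | Sum.inl a => if (a : ℕ) < 3 then 2 * a else 2 * a - 5
  | Sum.inr (Sum.inl a) => if (a : ℕ) < 3 then 2 * a else 2 * a - 5
  | Sum.inr (Sum.inr ck) => 2 * ck.2

/-- The coordinate pairs occupied by vertices of `Gₙ`. -/
def Valid (n x y : ℕ) : Prop :=
  ((x = 0 ∨ x = 2 * n) ∧ (y = 1 ∨ y = 3)) ∨
    (1 ≤ x ∧ x + 1 ≤ 2 * n ∧ (y = 0 ∨ y = 2 ∨ y = 4))

/-- Adjacency in coordinates. -/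
def Nbr (n x y x' y' : ℕ) : Prop :=
  (x = x' ∧ x % 2 = 0 ∧ 1 ≤ x ∧ x + 1 ≤ 2 * n ∧ (y' = y + 2 ∨ y = y' + 2)) ∨
    ((x' = x + 1 ∨ x = x' + 1) ∧ y ≤ y' + 1 ∧ y' ≤ y + 1)

/-- Whether a horizontal coordinate is extremal. -/
def tip (n x : ℕ) : ℕ := if x = 0 ∨ x = 2 * n then 1 else 0

/-- Distance in coordinates. -/
def D (n x y x' y' : ℕ) : ℕ :=
  if (x ≤ 1 ∧ x' ≤ 1) ∨ (2 * n ≤ x + 1 ∧ 2 * n ≤ x' + 1) then (y - y') + (y' - y)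
  else (x - x') + (x' - x) + ((y - y') + (y' - y) - tip n x - tip n x') / 2 +
    if x = x' ∧ x % 2 = 1 ∧ y ≠ y' then 2 else 0

theorem valid_coords {n : ℕ} (hn : 2 ≤ n) (u : GnV n) : Valid n (xc u) (yc u) := by
  rcases u with a | a | ⟨c, k⟩
  · simp only [xc, yc, Valid]; split_ifs <;> omega
  · simp only [xc, yc, Valid]; split_ifs <;> omega
  · simp only [xc, yc, Valid]; omega

theorem exists_coords {n x y : ℕ} (hn : 2 ≤ n) (h : Valid n x y) :
    ∃ u : GnV n, xc u = x ∧ yc u = y := by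
  unfold Valid at h
  by_cases h0 : x = 0
  · refine ⟨Sum.inl ⟨(y + 5) / 2, by omega⟩, ?_⟩
    simp only [xc, yc]; split_ifs <;> omega
  by_cases h1 : x = 1
  · refine ⟨Sum.inl ⟨y / 2, by omega⟩, ?_⟩
    simp only [xc, yc]; split_ifs <;> omega
  by_cases h2 : x = 2 * n
  · refine ⟨Sum.inr (Sum.inl ⟨(y + 5) / 2, by omega⟩), ?_⟩
    simp only [xc, yc]; split_ifs <;> omega
  by_cases h3 : x + 1 = 2 * n
  · refine ⟨Sum.inr (Sum.inl ⟨y / 2, by omega⟩), ?_⟩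
    simp only [xc, yc]; split_ifs <;> omega
  · refine ⟨Sum.inr (Sum.inr (⟨x - 2, by omega⟩,
      ⟨y / 2, by omega⟩)), ?_⟩
    simp only [xc, yc]; omega

theorem coords_injective {n : ℕ} (hn : 2 ≤ n) {u v : GnV n} (hx : xc u = xc v)
    (hy : yc u = yc v) : u = v := by
  rcases u with a | a | ⟨c, k⟩ <;> rcases v with b | b | ⟨d, l⟩ <;> simp only [xc, yc] at hx hy
  · refine congrArg Sum.inl (Fin.ext ?_)
    split_ifs at hx hy <;> omega
  · split_ifs at hx <;> omega
  · split_ifs at hx; omega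
  · split_ifs at hx <;> omega
  · refine congrArg (Sum.inr ∘ Sum.inl) (Fin.ext ?_)
    split_ifs at hx hy <;> omega
  · split_ifs at hx <;> omega
  · split_ifs at hx; omega
  · split_ifs at hx <;> omega
  · obtain rfl : c = d := Fin.ext (by omega)
    obtain rfl : k = l := Fin.ext (by omega)
    rfl

theorem adj_iff {n : ℕ} (hn : 2 ≤ n) (u v : GnV n) :
    (Gn n).Adj u v ↔ Nbr n (xc u) (yc u) (xc v) (yc v) := by
  have hne : u ≠ v ↔ ¬(xc u = xc v ∧ yc u = yc v) :=
    not_congr ⟨fun h => h ▸ ⟨rfl, rfl⟩, fun h => coords_injective hn h.1 h.2⟩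
  rw [Gn, SimpleGraph.fromRel_adj, hne]
  clear hne
  rcases u with a | a | ⟨c, k⟩ <;> rcases v with b | b | ⟨d, l⟩ <;>
    simp only [xc, yc, GnRel, gadgetRel, Nbr] <;> (try split_ifs) <;>
    (try simp only [or_false, false_or, and_false, false_and]) <;> lia

theorem D_self (n x y : ℕ) : D n x y x y = 0 := by
  simp [D]

set_option maxHeartbeats 0 in
theorem D_le_of_nbr {n x y x₁ y₁ x' y' : ℕ} (hn : 2 ≤ n) (h : Valid n x y) (h₁ : Valid n x₁ y₁)
    (h' : Valid n x' y') (ha : Nbr n x y x₁ y₁) : D n x y x' y' ≤ D n x₁ y₁ x' y' + 1 := by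
  rcases ha with ⟨rfl, ha1, ha2, ha3, ha⟩ | ⟨ha, hb, hc⟩
  · have e1 : ¬((x ≤ 1 ∧ x' ≤ 1) ∨ (2 * n ≤ x + 1 ∧ 2 * n ≤ x' + 1)) := by omega
    have e2 : ∀ z, ¬(x = x' ∧ x % 2 = 1 ∧ z ≠ y') := by omega
    simp only [D, e1, e2, if_false]
    omega
  unfold Valid at *
  obtain hx | hx | ⟨hx, hx2⟩ | hx | hx : x = 0 ∨ x = 1 ∨ (2 ≤ x ∧ x + 2 ≤ 2 * n) ∨ x + 1 = 2 * n ∨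
      x = 2 * n := by omega
  all_goals
    obtain hx' | hx' | ⟨hx', hx2'⟩ | hx' | hx' :
      x' = 0 ∨ x' = 1 ∨ (2 ≤ x' ∧ x' + 2 ≤ 2 * n) ∨ x' + 1 = 2 * n ∨ x' = 2 * n := by omega
  all_goals rcases ha with rfl | ha <;> try (exfalso; omega)
  all_goals simp (disch := omega) only [D, tip, if_pos, if_neg]
  all_goals (try split_ifs) <;> omega

set_option maxHeartbeats 0 in
theorem exists_nbr_D_lt {n x y x' y' : ℕ} (hn : 2 ≤ n) (h : Valid n x y)
    (h' : Valid n x' y') (hne : ¬(x = x' ∧ y = y')) :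
    ∃ x₁ y₁, Valid n x₁ y₁ ∧ Nbr n x y x₁ y₁ ∧ D n x₁ y₁ x' y' < D n x y x' y' := by
  unfold Valid Nbr at *
  by_cases hv : x % 2 = 0 ∧ 1 ≤ x ∧ x + 1 ≤ 2 * n ∧ (y + 2 ≤ y' ∨ y' + 2 ≤ y)
  · have hz : ¬((x ≤ 1 ∧ x' ≤ 1) ∨ (2 * n ≤ x + 1 ∧ 2 * n ≤ x' + 1)) := by omega
    have ho : ∀ z, ¬(x = x' ∧ x % 2 = 1 ∧ z ≠ y') := by omega
    simp only [D, tip]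
    obtain ⟨hx, hx1, hx2, hy | hy⟩ := hv
    · refine ⟨x, y + 2, by omega, by omega, ?_⟩
      simp only [hz, ho, if_false]
      split_ifs <;> omega
    · refine ⟨x, y - 2, by omega, by omega, ?_⟩
      simp only [hz, ho, if_false]
      split_ifs <;> omega
  by_cases hm : (2 ≤ x ∧ x + 2 ≤ 2 * n) ∧ 2 ≤ x' ∧ x' + 2 ≤ 2 * n
  · rcases le_or_gt x x' with hx | hx
    · refine ⟨x + 1, y, by omega, by omega, ?_⟩
      simp (disch := omega) only [D, tip, if_neg]
      split_ifs <;> omega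
    · refine ⟨x - 1, y, by omega, by omega, ?_⟩
      simp (disch := omega) only [D, tip, if_neg]
      omega
  obtain hx' | hx' | ⟨hx', hx2'⟩ | hx' | hx' :
    x' = 0 ∨ x' = 1 ∨ (2 ≤ x' ∧ x' + 2 ≤ 2 * n) ∨ x' + 1 = 2 * n ∨ x' = 2 * n := by omega
  all_goals
    obtain hx | hx | ⟨hx, hx2⟩ | hx | hx : x = 0 ∨ x = 1 ∨ (2 ≤ x ∧ x + 2 ≤ 2 * n) ∨
      x + 1 = 2 * n ∨ x = 2 * n := by omega
  all_goals obtain hy | hy | hy : y < y' ∨ y = y' ∨ y' < y := by omega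
  all_goals first
    | exfalso; omega
    | refine ⟨x + 1, y, by omega, by omega, ?_⟩
      simp (disch := omega) only [D, tip, if_pos, if_neg]
      (try split_ifs) <;> omega
    | refine ⟨x - 1, y, by omega, by omega, ?_⟩
      simp (disch := omega) only [D, tip, if_pos, if_neg]
      (try split_ifs) <;> omega
    | refine ⟨x + 1, y + 1, by omega, by omega, ?_⟩
      simp (disch := omega) only [D, tip, if_pos, if_neg]
      omega
    | refine ⟨x + 1, y - 1, by omega, by omega, ?_⟩
      simp (disch := omega) only [D, tip, if_pos, if_neg]
      omega
    | refine ⟨x - 1, y + 1, by omega, by omega, ?_⟩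
      simp (disch := omega) only [D, tip, if_pos, if_neg]
      omega
    | refine ⟨x - 1, y - 1, by omega, by omega, ?_⟩
      simp (disch := omega) only [D, tip, if_pos, if_neg]
      omega

theorem dist_eq {n : ℕ} (hn : 2 ≤ n) (u v : GnV n) :
    (Gn n).dist u v = D n (xc u) (yc u) (xc v) (yc v) := by
  refine (Gn n).dist_eq_of_local (fun u v => D n (xc u) (yc u) (xc v) (yc v))
    (fun v => D_self _ _ _) (fun u v w h => ?_) (fun u w h => ?_) u v
  · exact D_le_of_nbr hn (valid_coords hn u) (valid_coords hn v) (valid_coords hn w)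
      ((adj_iff hn u v).1 h)
  · obtain ⟨x, y, hv, ha, hlt⟩ := exists_nbr_D_lt hn (valid_coords hn u) (valid_coords hn w)
      (fun hc => h (coords_injective hn hc.1 hc.2))
    obtain ⟨v, rfl, rfl⟩ := exists_coords hn hv
    exact ⟨v, (adj_iff hn u v).2 ha, hlt⟩

theorem degR_eq {n : ℕ} (hn : 2 ≤ n) {u : GnV n} {x y : ℕ} (hx : xc u = x) (hy : yc u = y)
    (s : Finset (ℕ × ℕ)) (hs : ∀ x₁ y₁, (x₁, y₁) ∈ s ↔ Valid n x₁ y₁ ∧ Nbr n x y x₁ y₁) :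
    (Gn n).degR u = s.card := by
  subst hx hy
  have hinj : Function.Injective (fun w : GnV n => (xc w, yc w)) := fun a b h =>
    coords_injective hn (congrArg Prod.fst h) (congrArg Prod.snd h)
  have himg : (fun w : GnV n => (xc w, yc w)) '' {w | (Gn n).Adj u w} = s := by
    ext ⟨x, y⟩
    simp only [Set.mem_image, Set.mem_ofPred_eq, Finset.mem_coe, hs, adj_iff hn]
    constructor
    · rintro ⟨w, hw, he⟩
      obtain ⟨rfl, rfl⟩ := Prod.mk.inj he
      exact ⟨valid_coords hn w, hw⟩
    · rintro ⟨hv, ha⟩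
      obtain ⟨w, rfl, rfl⟩ := exists_coords hn hv
      exact ⟨w, ha, rfl⟩
  rw [SimpleGraph.degR, Nat.card_coe_set_eq, ← Set.ncard_image_of_injective _ hinj, himg,
    Set.ncard_coe_finset]

/-- The vertices of the left end gadget. -/
def left {n : ℕ} (a : Fin 5) : GnV n := Sum.inl a

/-- The vertices of the right end gadget. -/
def right {n : ℕ} (a : Fin 5) : GnV n := Sum.inr (Sum.inl a)

/-- The vertices of the columns. -/
def col {n : ℕ} (c : Fin (2 * n - 3)) (k : Fin 3) : GnV n := Sum.inr (Sum.inr (c, k))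

theorem sum_GnV {n : ℕ} (f : GnV n → ℝ) :
    ∑ u, f u = ∑ a, f (left a) + (∑ a, f (right a) + ∑ c, ∑ k, f (col c k)) := by
  refine (Fintype.sum_sum_type (α₁ := Fin 5) (α₂ := Fin 5 ⊕ (Fin (2 * n - 3) × Fin 3)) f).trans ?_
  rw [Fintype.sum_sum_type, Fintype.sum_prod_type]
  rfl

theorem degR_left {n : ℕ} (hn : 2 ≤ n) (a : Fin 5) :
    (Gn n).degR (left a : GnV n) = (![2, 3, 2, 2, 2] : Fin 5 → ℝ) a := by
  fin_cases a
  · refine (degR_eq (x := 1) (y := 0) hn rfl rfl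
        {(0, 1), (2, 0)} ?_).trans ?_
    · simp [Valid, Nbr]; lia
    · simp
  · refine (degR_eq (x := 1) (y := 2) hn rfl rfl
        {(0, 1), (0, 3), (2, 2)} ?_).trans ?_
    · simp [Valid, Nbr]; lia
    · simp
  · refine (degR_eq (x := 1) (y := 4) hn rfl rfl
        {(0, 3), (2, 4)} ?_).trans ?_
    · simp [Valid, Nbr]; lia
    · simp
  · refine (degR_eq (x := 0) (y := 1) hn rfl rfl
        {(1, 0), (1, 2)} ?_).trans ?_
    · simp [Valid, Nbr]; lia
    · simp
  · refine (degR_eq (x := 0) (y := 3) hn rfl rfl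
        {(1, 2), (1, 4)} ?_).trans ?_
    · simp [Valid, Nbr]; lia
    · simp

theorem degR_right {n : ℕ} (hn : 2 ≤ n) (a : Fin 5) :
    (Gn n).degR (right a : GnV n) = (![2, 3, 2, 2, 2] : Fin 5 → ℝ) a := by
  fin_cases a
  · refine (degR_eq (x := 2 * n - 1) (y := 0) hn rfl rfl
        {(2 * n, 1), (2 * n - 2, 0)} ?_).trans ?_
    · simp [Valid, Nbr]; lia
    · simp
  · refine (degR_eq (x := 2 * n - 1) (y := 2) hn rfl rfl
        {(2 * n, 1), (2 * n, 3), (2 * n - 2, 2)} ?_).trans ?_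
    · simp [Valid, Nbr]; lia
    · simp
  · refine (degR_eq (x := 2 * n - 1) (y := 4) hn rfl rfl
        {(2 * n, 3), (2 * n - 2, 4)} ?_).trans ?_
    · simp [Valid, Nbr]; lia
    · simp
  · refine (degR_eq (x := 2 * n) (y := 1) hn rfl rfl
        {(2 * n - 1, 0), (2 * n - 1, 2)} ?_).trans ?_
    · simp [Valid, Nbr]; lia
    · simp
  · refine (degR_eq (x := 2 * n) (y := 3) hn rfl rfl
        {(2 * n - 1, 2), (2 * n - 1, 4)} ?_).trans ?_
    · simp [Valid, Nbr]; lia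
    · simp

/-- Degrees along a column. -/
def colDeg (c : ℕ) (k : Fin 3) : ℝ := if c % 2 = 0 then ![3, 4, 3] k else 2

theorem degR_col {n : ℕ} (hn : 2 ≤ n) (c : Fin (2 * n - 3)) (k : Fin 3) :
    (Gn n).degR (col c k) = colDeg c k := by
  have hc := c.2
  by_cases hp : (c : ℕ) % 2 = 0
  · simp only [colDeg, if_pos hp]
    fin_cases k
    · refine (degR_eq (x := c + 2) (y := 0) hn rfl rfl
        {((c : ℕ) + 1, 0), ((c : ℕ) + 3, 0), ((c : ℕ) + 2, 2)} ?_).trans ?_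
      · simp [Valid, Nbr]; lia
      · simp
    · refine (degR_eq (x := c + 2) (y := 2) hn rfl rfl
        {((c : ℕ) + 1, 2), ((c : ℕ) + 3, 2), ((c : ℕ) + 2, 0), ((c : ℕ) + 2, 4)} ?_).trans ?_
      · simp [Valid, Nbr]; lia
      · simp
    · refine (degR_eq (x := c + 2) (y := 4) hn rfl rfl
        {((c : ℕ) + 1, 4), ((c : ℕ) + 3, 4), ((c : ℕ) + 2, 2)} ?_).trans ?_
      · simp [Valid, Nbr]; lia
      · simp
  · simp only [colDeg, if_neg hp]
    refine (degR_eq (x := c + 2) (y := 2 * k) hn rfl rfl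
        {((c : ℕ) + 1, 2 * (k : ℕ)), ((c : ℕ) + 3, 2 * (k : ℕ))} ?_).trans ?_
    · simp [Valid, Nbr]; lia
    · simp

/-- Distances within an end gadget. -/
def endEnd : Fin 5 → Fin 5 → ℕ :=
  ![![0, 2, 4, 1, 3], ![2, 0, 2, 1, 1], ![4, 2, 0, 3, 1], ![1, 1, 3, 0, 2], ![3, 1, 1, 2, 0]]

/-- Distances between opposite end gadgets, after subtracting `2n - 2`. -/
def endOpp : Fin 5 → Fin 5 → ℕ :=
  ![![0, 1, 2, 1, 2], ![1, 0, 1, 1, 1], ![2, 1, 0, 2, 1], ![1, 1, 2, 2, 2], ![2, 1, 1, 2, 2]]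

/-- Distances between an end gadget and the column next to it. -/
def endCol : Fin 5 → Fin 3 → ℕ :=
  ![![1, 2, 3], ![2, 1, 2], ![3, 2, 1], ![2, 2, 3], ![3, 2, 2]]

/-- Horizontal coordinates of the left end gadget. -/
def endX : Fin 5 → ℕ := ![1, 1, 1, 0, 0]

/-- Vertical coordinates of the end gadgets. -/
def endY : Fin 5 → ℕ := ![0, 2, 4, 1, 3]

theorem xc_left {n : ℕ} (a : Fin 5) : xc (left a : GnV n) = endX a := by
  fin_cases a <;> rfl

theorem yc_left {n : ℕ} (a : Fin 5) : yc (left a : GnV n) = endY a := by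
  fin_cases a <;> rfl

theorem xc_right {n : ℕ} (a : Fin 5) : xc (right a : GnV n) = 2 * n - endX a := by
  fin_cases a <;> rfl

theorem yc_right {n : ℕ} (a : Fin 5) : yc (right a : GnV n) = endY a := by
  fin_cases a <;> rfl

theorem xc_col {n : ℕ} (c : Fin (2 * n - 3)) (k : Fin 3) : xc (col c k) = c + 2 := rfl

theorem yc_col {n : ℕ} (c : Fin (2 * n - 3)) (k : Fin 3) : yc (col c k) = 2 * k := rfl

theorem dist_left_left {n : ℕ} (hn : 2 ≤ n) (a b : Fin 5) :
    (Gn n).dist (left a) (left b) = endEnd a b := by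
  rw [dist_eq hn, xc_left, xc_left, yc_left, yc_left]
  fin_cases a <;> fin_cases b <;> simp [endX, endY, D, endEnd]

theorem dist_right_right {n : ℕ} (hn : 2 ≤ n) (a b : Fin 5) :
    (Gn n).dist (right a) (right b) = endEnd a b := by
  rw [dist_eq hn, xc_right, xc_right, yc_right, yc_right]
  have h : 2 * n ≤ 2 * n - 1 + 1 := by omega
  fin_cases a <;> fin_cases b <;> simp [endX, endY, D, endEnd, h]

theorem dist_left_right {m : ℕ} (a b : Fin 5) :
    (Gn (m + 2)).dist (left a) (right b) = 2 * m + 2 + endOpp a b := by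
  rw [dist_eq (by omega), xc_left, xc_right, yc_left, yc_right]
  fin_cases a <;> fin_cases b <;> simp [endX, endY, D, endOpp, tip] <;> lia

theorem dist_left_col {n : ℕ} (hn : 2 ≤ n) (a : Fin 5) (c : Fin (2 * n - 3)) (k : Fin 3) :
    (Gn n).dist (left a) (col c k) = c + endCol a k := by
  have hc := c.2
  rw [dist_eq hn, xc_left, xc_col, yc_left, yc_col]
  fin_cases a <;> fin_cases k <;> simp [endX, endY, D, endCol, tip] <;> lia

theorem dist_right_col {m : ℕ} (a : Fin 5) (c : Fin (2 * (m + 2) - 3)) (k : Fin 3) :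
    (Gn (m + 2)).dist (right a) (col c k) = (2 * m - c) + endCol a k := by
  have hc := c.2
  rw [dist_eq (by omega), xc_right, xc_col, yc_right, yc_col]
  fin_cases a <;> fin_cases k <;> simp [endX, endY, D, endCol, tip] <;> lia

/-- Distances between column vertices. -/
def colCol (c d k l : ℕ) : ℕ :=
  (c - d) + (d - c) + ((k - l) + (l - k)) + if c = d ∧ c % 2 = 1 ∧ k ≠ l then 2 else 0

theorem dist_col_col {n : ℕ} (hn : 2 ≤ n) (c d : Fin (2 * n - 3)) (k l : Fin 3) :
    (Gn n).dist (col c k) (col d l) = colCol c d k l := by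
  have hc := c.2
  have hd := d.2
  rw [dist_eq hn, xc_col, xc_col, yc_col, yc_col]
  have e : ((c : ℕ) + 2 = d + 2 ∧ ((c : ℕ) + 2) % 2 = 1 ∧ 2 * (k : ℕ) ≠ 2 * l) ↔
      ((c : ℕ) = d ∧ (c : ℕ) % 2 = 1 ∧ (k : ℕ) ≠ l) := by omega
  simp (disch := omega) only [D, tip, colCol, e, if_neg]
  omega

/-- The indicator of even numbers. -/
def par (c : ℕ) : ℝ := if c % 2 = 0 then 1 else 0

theorem par_even (m : ℕ) : par (2 * m) = 1 := by simp [par]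

theorem par_odd (m : ℕ) : par (2 * m + 1) = 0 := by simp [par, Nat.add_mod]

theorem colDeg_eq (c : ℕ) (k : Fin 3) : colDeg c k = 2 + par c * (![1, 2, 1] : Fin 3 → ℝ) k := by
  unfold colDeg par
  split_ifs <;> fin_cases k <;> norm_num

theorem sum_range_odd_succ (f : ℕ → ℝ) (m : ℕ) :
    ∑ c ∈ Finset.range (2 * (m + 1) + 1), f c =
      ∑ c ∈ Finset.range (2 * m + 1), f c + f (2 * m + 1) + f (2 * m + 2) := by
  rw [show 2 * (m + 1) + 1 = 2 * m + 1 + 1 + 1 by ring, Finset.sum_range_succ,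
    Finset.sum_range_succ]

theorem sum_linear (α β γ δ : ℝ) (m : ℕ) :
    ∑ c ∈ Finset.range (2 * m + 1), (α + β * par c + (γ + δ * par c) * c) =
      α * (2 * m + 1) + β * (m + 1) + γ * (m * (2 * m + 1)) + δ * (m * (m + 1)) := by
  induction m with
  | zero => simp [par]
  | succ m ih =>
    rw [sum_range_odd_succ, ih, par_odd, show 2 * m + 2 = 2 * (m + 1) by ring, par_even]
    push_cast
    ring

theorem sum_colCol (c d : ℕ) :
    ∑ k : Fin 3, ∑ l : Fin 3, (colDeg c k + colDeg d l) * (colCol c d k l : ℝ) =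
      (36 + 12 * par c + 12 * par d) * ((c - d + (d - c) : ℕ) : ℝ) + 32 + 10 * par c +
        10 * par d + if c = d then 48 - 48 * par c else 0 := by
  generalize hx : c - d + (d - c) = x
  simp only [colDeg_eq, colCol, hx, par, Fin.sum_univ_three]
  rcases Nat.mod_two_eq_zero_or_one c with hc | hc <;>
    rcases Nat.mod_two_eq_zero_or_one d with hd | hd <;>
    by_cases h : c = d <;> simp [hc, hd, h] <;> try ring

theorem sum_endCol (c x : ℕ) :
    ∑ a : Fin 5, ∑ k : Fin 3, ((![2, 3, 2, 2, 2] : Fin 5 → ℝ) a + colDeg c k) *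
      ((x + endCol a k : ℕ) : ℝ) = 129 + 40 * par c + (63 + 20 * par c) * x := by
  simp [colDeg_eq, Fin.sum_univ_five, Fin.sum_univ_three, endCol]
  ring

theorem sum_weighted_sub (m : ℕ) :
    ∑ c ∈ Finset.range (2 * m + 1), ∑ d ∈ Finset.range (2 * m + 1),
      (36 + 12 * par c + 12 * par d) * ((c - d + (d - c) : ℕ) : ℝ) =
      88 * m + 216 * m ^ 2 + 128 * m ^ 3 := by
  induction m with
  | zero => simp
  | succ m ih =>
    have h₁ : ∀ t c : ℕ, c ∈ Finset.range (2 * m + 1) →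
        (c - (2 * m + 1 + t) + (2 * m + 1 + t - c) : ℕ) = (2 * m + 1 + t : ℝ) - c := by
      intro t c hc
      have := Finset.mem_range.1 hc
      rw [Nat.sub_eq_zero_of_le (by omega), zero_add, Nat.cast_sub (by omega)]
      push_cast
      rfl
    have key : ∀ t : ℕ, ∑ c ∈ Finset.range (2 * m + 1),
        (36 + 12 * par c + 12 * par (2 * m + 1 + t)) *
        ((c - (2 * m + 1 + t) + (2 * m + 1 + t - c) : ℕ) : ℝ) =
        (36 + 12 * par (2 * m + 1 + t)) * (2 * m + 1 + t) * (2 * m + 1) +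
          12 * (2 * m + 1 + t) * (m + 1) -
          (36 + 12 * par (2 * m + 1 + t)) * (m * (2 * m + 1)) - 12 * (m * (m + 1)) := by
      intro t
      rw [Finset.sum_congr rfl fun c hc => by rw [h₁ t c hc]]
      refine (Finset.sum_congr rfl fun c _ => ?_).trans ((sum_linear
        ((36 + 12 * par (2 * m + 1 + t)) * (2 * m + 1 + t)) (12 * (2 * m + 1 + t))
        (-(36 + 12 * par (2 * m + 1 + t))) (-12) m).trans ?_) <;> ring
    have key' : ∀ t : ℕ, ∑ c ∈ Finset.range (2 * m + 1),
        (36 + 12 * par (2 * m + 1 + t) + 12 * par c) *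
        ((2 * m + 1 + t - c + (c - (2 * m + 1 + t)) : ℕ) : ℝ) = _ := fun t =>
      (Finset.sum_congr rfl fun c _ => by
        rw [Nat.add_comm (2 * m + 1 + t - c), add_right_comm]).trans (key t)
    have h0 := key 0
    have h1 := key 1
    have h0' := key' 0
    have h1' := key' 1
    simp only [add_zero, Nat.reduceAdd, add_assoc (2 * m) 1 1] at h0 h1 h0' h1'
    simp only [sum_range_odd_succ, Finset.sum_add_distrib] at *
    rw [ih, h0, h1, h0', h1', par_odd, show 2 * m + 2 = 2 * (m + 1) by ring, par_even,
      show 2 * m + 1 - 2 * (m + 1) = 0 by omega, show 2 * (m + 1) - (2 * m + 1) = 1 by omega]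
    push_cast
    simp
    ring

theorem sum_columns {m : ℕ} (f : ℕ → ℝ) :
    ∑ c : Fin (2 * (m + 2) - 3), f c = ∑ c ∈ Finset.range (2 * m + 1), f c :=
  Fin.sum_univ_eq_sum_range f (2 * m + 1)

theorem sum_endEnd :
    ∑ a : Fin 5, ∑ b : Fin 5, ((![2, 3, 2, 2, 2] : Fin 5 → ℝ) a +
      (![2, 3, 2, 2, 2] : Fin 5 → ℝ) b) * (endEnd a b : ℝ) = 172 := by
  simp [Fin.sum_univ_five, endEnd]
  norm_num

theorem sum_endOpp (m : ℕ) :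
    ∑ a : Fin 5, ∑ b : Fin 5, ((![2, 3, 2, 2, 2] : Fin 5 → ℝ) a +
      (![2, 3, 2, 2, 2] : Fin 5 → ℝ) b) * ((2 * m + 2 + endOpp a b : ℕ) : ℝ) =
      356 + 220 * m := by
  simp [Fin.sum_univ_five, endOpp]
  ring

theorem sum_left_col (m : ℕ) :
    ∑ a : Fin 5, ∑ c : Fin (2 * (m + 2) - 3), ∑ k : Fin 3,
      ((![2, 3, 2, 2, 2] : Fin 5 → ℝ) a + colDeg c k) * ((c + endCol a k : ℕ) : ℝ) =
      169 + 381 * m + 146 * m ^ 2 := by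
  rw [Finset.sum_comm]
  simp only [sum_endCol]
  rw [sum_columns fun c => 129 + 40 * par c + (63 + 20 * par c) * c, sum_linear]
  ring

theorem sum_right_col (m : ℕ) :
    ∑ a : Fin 5, ∑ c : Fin (2 * (m + 2) - 3), ∑ k : Fin 3,
      ((![2, 3, 2, 2, 2] : Fin 5 → ℝ) a + colDeg c k) * ((2 * m - c + endCol a k : ℕ) : ℝ) =
      169 + 381 * m + 146 * m ^ 2 := by
  rw [Finset.sum_comm]
  simp only [sum_endCol]
  rw [sum_columns fun c => 129 + 40 * par c + (63 + 20 * par c) * ((2 * m - c : ℕ) : ℝ)]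
  have h : ∀ c ∈ Finset.range (2 * m + 1),
      129 + 40 * par c + (63 + 20 * par c) * ((2 * m - c : ℕ) : ℝ) =
        (129 + 126 * m) + (40 + 40 * m) * par c + (-63 + (-20) * par c) * c := by
    intro c hc
    have := Finset.mem_range.1 hc
    rw [Nat.cast_sub (by omega)]
    push_cast
    ring
  rw [Finset.sum_congr rfl h, sum_linear]
  ring

theorem sum_col_col (m : ℕ) :
    ∑ c : Fin (2 * (m + 2) - 3), ∑ k : Fin 3, ∑ d : Fin (2 * (m + 2) - 3), ∑ l : Fin 3,
      (colDeg c k + colDeg d l) * (colCol c d k l : ℝ) =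
      52 + 324 * m + 384 * m ^ 2 + 128 * m ^ 3 := by
  have h : ∀ c : Fin (2 * (m + 2) - 3), ∑ k : Fin 3, ∑ d : Fin (2 * (m + 2) - 3), ∑ l : Fin 3,
      (colDeg c k + colDeg d l) * (colCol c d k l : ℝ) =
      ∑ d ∈ Finset.range (2 * m + 1), (36 + 12 * par c + 12 * par d) *
        ((c - d + (d - c) : ℕ) : ℝ) + ((32 + 10 * par c) * (2 * m + 1) + 10 * (m + 1)) +
        (48 - 48 * par c) := by
    intro c
    have hc : (c : ℕ) ∈ Finset.range (2 * m + 1) := Finset.mem_range.2 (by omega)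
    have hl := sum_linear (32 + 10 * par c) 10 0 0 m
    rw [Finset.sum_comm]
    simp only [sum_colCol]
    rw [sum_columns fun d => (36 + 12 * par c + 12 * par d) * ((c - d + (d - c) : ℕ) : ℝ) + 32 +
      10 * par c + 10 * par d + if (c : ℕ) = d then 48 - 48 * par c else 0]
    rw [Finset.sum_add_distrib, Finset.sum_ite_eq, if_pos hc]
    simp only [zero_mul, add_zero] at hl
    simp only [add_assoc, ← hl, Finset.sum_add_distrib]
  rw [Finset.sum_congr rfl fun c _ => h c, sum_columns fun c =>
    ∑ d ∈ Finset.range (2 * m + 1), (36 + 12 * par c + 12 * par d) *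
        ((c - d + (d - c) : ℕ) : ℝ) + ((32 + 10 * par c) * (2 * m + 1) + 10 * (m + 1)) +
        (48 - 48 * par c)]
  simp only [add_assoc]
  rw [Finset.sum_add_distrib]
  have := sum_weighted_sub m
  simp only [add_assoc] at this
  rw [this]
  have hl := sum_linear (32 * (2 * m + 1) + 10 * (m + 1) + 48) (10 * (2 * m + 1) - 48) 0 0 m
  rw [show 52 + (324 * (m : ℝ) + (384 * m ^ 2 + 128 * m ^ 3)) =
    88 * m + (216 * m ^ 2 + 128 * m ^ 3) +
      ((32 * (2 * m + 1) + 10 * (m + 1) + 48) * (2 * m + 1) +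
        (10 * (2 * m + 1) - 48) * (m + 1) + 0 * (m * (2 * m + 1)) + 0 * (m * (m + 1))) by ring,
    ← hl]
  refine congrArg _ (Finset.sum_congr rfl fun c _ => ?_)
  ring

end Gn

/-- For the family `Gₙ` (`n ≥ 2`),
`DD(Gₙ) = 64n³ + 100n² − 24n + 28`. -/
theorem degreeDistance_Gn (n : ℕ) (hn : 2 ≤ n) :
    (Gn n).degreeDistance =
      64 * (n : ℝ) ^ 3 + 100 * (n : ℝ) ^ 2 - 24 * (n : ℝ) + 28 := by
  obtain ⟨m, rfl⟩ : ∃ m, n = m + 2 := ⟨n - 2, by omega⟩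
  have sym : ∀ u v : GnV (m + 2),
      ((Gn (m + 2)).degR u + (Gn (m + 2)).degR v) * ((Gn (m + 2)).dist u v : ℝ) =
      ((Gn (m + 2)).degR v + (Gn (m + 2)).degR u) * ((Gn (m + 2)).dist v u : ℝ) := fun u v => by
    rw [add_comm, SimpleGraph.dist_comm]
  have hLL : ∑ a, ∑ b, ((Gn (m + 2)).degR (Gn.left a) + (Gn (m + 2)).degR (Gn.left b)) *
      ((Gn (m + 2)).dist (Gn.left a) (Gn.left b) : ℝ) = 172 := by
    simp only [Gn.degR_left hn, Gn.dist_left_left hn, Gn.sum_endEnd]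
  have hRR : ∑ a, ∑ b, ((Gn (m + 2)).degR (Gn.right a) + (Gn (m + 2)).degR (Gn.right b)) *
      ((Gn (m + 2)).dist (Gn.right a) (Gn.right b) : ℝ) = 172 := by
    simp only [Gn.degR_right hn, Gn.dist_right_right hn, Gn.sum_endEnd]
  have hLR : ∑ a, ∑ b, ((Gn (m + 2)).degR (Gn.left a) + (Gn (m + 2)).degR (Gn.right b)) *
      ((Gn (m + 2)).dist (Gn.left a) (Gn.right b) : ℝ) = 356 + 220 * m := by
    simp only [Gn.degR_left hn, Gn.degR_right hn, Gn.dist_left_right, Gn.sum_endOpp]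
  have hLC : ∑ a, ∑ c, ∑ k, ((Gn (m + 2)).degR (Gn.left a) + (Gn (m + 2)).degR (Gn.col c k)) *
      ((Gn (m + 2)).dist (Gn.left a) (Gn.col c k) : ℝ) = 169 + 381 * m + 146 * m ^ 2 := by
    simp only [Gn.degR_left hn, Gn.degR_col hn, Gn.dist_left_col hn, Gn.sum_left_col]
  have hRC : ∑ a, ∑ c, ∑ k, ((Gn (m + 2)).degR (Gn.right a) + (Gn (m + 2)).degR (Gn.col c k)) *
      ((Gn (m + 2)).dist (Gn.right a) (Gn.col c k) : ℝ) = 169 + 381 * m + 146 * m ^ 2 := by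
    simp only [Gn.degR_right hn, Gn.degR_col hn, Gn.dist_right_col, Gn.sum_right_col]
  have hCC : ∑ c, ∑ k, ∑ d, ∑ l, ((Gn (m + 2)).degR (Gn.col c k) +
      (Gn (m + 2)).degR (Gn.col d l)) * ((Gn (m + 2)).dist (Gn.col c k) (Gn.col d l) : ℝ) =
      52 + 324 * m + 384 * m ^ 2 + 128 * m ^ 3 := by
    simp only [Gn.degR_col hn, Gn.dist_col_col hn, Gn.sum_col_col]
  have swap : ∀ f : GnV (m + 2) → GnV (m + 2) → ℝ, (∀ u v, f u v = f v u) →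
      ∀ g : Fin 5 → GnV (m + 2),
      ∑ c, ∑ k, ∑ a, f (Gn.col c k) (g a) = ∑ a, ∑ c, ∑ k, f (g a) (Gn.col c k) := by
    intro f hf g
    rw [Finset.sum_comm (s := (Finset.univ : Finset (Fin 5)))]
    refine Finset.sum_congr rfl fun c _ => ?_
    rw [Finset.sum_comm]
    exact Finset.sum_congr rfl fun a _ => Finset.sum_congr rfl fun k _ => hf _ _
  have hCL := (swap _ sym Gn.left).trans hLC
  have hCR := (swap _ sym Gn.right).trans hRC
  have hRL : ∑ a, ∑ b, ((Gn (m + 2)).degR (Gn.right a) + (Gn (m + 2)).degR (Gn.left b)) *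
      ((Gn (m + 2)).dist (Gn.right a) (Gn.left b) : ℝ) = 356 + 220 * m := by
    rw [Finset.sum_comm, ← hLR]
    exact Finset.sum_congr rfl fun a _ => Finset.sum_congr rfl fun b _ => sym _ _
  rw [SimpleGraph.degreeDistance]
  simp only [Gn.sum_GnV, Finset.sum_add_distrib]
  rw [hLL, hLR, hLC, hRL, hRR, hRC, hCL, hCR, hCC]
  push_cast
  ring

end
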